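/- Fix 0 < δ < 1/20. There exist constants 0 < a₂, A₂ < ∞ depending only on δ, and σ₀ > 0, such that for all 0 < σ < σ₀, with S = ⌈A₂·σ^{−a₂}⌉: sup over x, y ∈ (−σ^{−9}, −δ) of ‖K̂_σ^S(x,·) − K̂_σ^S(y,·)‖_TV ≤ A₂·e^{−a₂·σ^{−5}}. -/

import Mathlib

open MeasureTheory Filter Set

/-- Gaussian density `φ_σ` with mean 0 and variance `σ²`. -/
noncomputable def gaussDensity (σ x : ℝ) : ℝ :=
  (Real.sqrt (2 * Real.pi * σ ^ 2))⁻¹ * Real.exp (-(x ^ 2) / (2 * σ ^ 2))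

/-- Density `f_σ` of the mixture `½ N(-1,σ²) + ½ N(1,σ²)`. -/
noncomputable def mixDensity (σ x : ℝ) : ℝ :=
  (1 / 2) * gaussDensity σ (x + 1) + (1 / 2) * gaussDensity σ (x - 1)

/-- The `N(0,σ²)` measure, defined via its density `φ_σ` w.r.t. Lebesgue measure. -/
noncomputable def gaussMeasure (σ : ℝ) : Measure ℝ :=
  volume.withDensity fun z => ENNReal.ofReal (gaussDensity σ z)

/-- The random-walk Metropolis kernel `K_σ(x, ·)` as a measure: the accepted-move part
has density `min(1, f_σ(y)/f_σ(x))` w.r.t. the proposal `x + N(0,σ²)`, and the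
remaining mass `1 − ∫ min(1, f_σ(x+z)/f_σ(x)) φ_σ(z) dz` stays at `x`. -/
noncomputable def rwmKernel (σ : ℝ) (x : ℝ) : Measure ℝ :=
  ((gaussMeasure σ).map (fun z => x + z)).withDensity
      (fun y => ENNReal.ofReal (min 1 (mixDensity σ y / mixDensity σ x)))
  + (ENNReal.ofReal
      (1 - ∫ z, min 1 (mixDensity σ (x + z) / mixDensity σ x) * gaussDensity σ z))
      • Measure.dirac x

/-- The restricted Metropolis–Hastings kernel `K̂_σ` on `(-∞,0)`:
`K̂_σ(x,A) = K_σ(x, A ∩ (-∞,0)) + 1_A(x) K_σ(x,[0,∞))`. -/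
noncomputable def rwmKernelHat (σ : ℝ) (x : ℝ) : Measure ℝ :=
  (rwmKernel σ x).restrict (Set.Iio 0) + (rwmKernel σ x (Set.Ici 0)) • Measure.dirac x

/-- `n`-step iterate of a (measure-valued) transition kernel. -/
noncomputable def kiter {α : Type*} [MeasurableSpace α] (κ : α → Measure α) :
    ℕ → α → Measure α
  | 0 => fun x => Measure.dirac x
  | n + 1 => fun x => (kiter κ n x).bind κ

open ProbabilityTheory
open scoped ENNReal

section Harris

variable {α : Type*} [MeasurableSpace α]

/-- Two measures of equal mass integrate a function of controlled oscillation almost equally. -/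
lemma lintegral_le_lintegral_add_of_oscillation {μ ν : Measure α} {m : ℝ≥0∞} (hm0 : m ≠ 0)
    (hm : m ≠ ∞) (hμ : μ univ = m) (hν : ν univ = m) {φ W : α → ℝ≥0∞} (hφ : Measurable φ)
    (hW : Measurable W) {c : ℝ≥0∞} (h : ∀ a b, φ a ≤ φ b + c * (2 + W a + W b)) :
    ∫⁻ a, φ a ∂μ ≤ ∫⁻ b, φ b ∂ν + c * (2 * m + ∫⁻ a, W a ∂μ + ∫⁻ b, W b ∂ν) := by
  have h1 : ∀ a, m * φ a ≤ ∫⁻ b, φ b ∂ν + c * (2 * m + m * W a + ∫⁻ b, W b ∂ν) := by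
    intro a
    calc m * φ a = ∫⁻ _, φ a ∂ν := by rw [lintegral_const, hν, mul_comm]
      _ ≤ ∫⁻ b, (φ b + c * (2 + W a + W b)) ∂ν := lintegral_mono fun b => h a b
      _ = _ := by
        rw [lintegral_add_left hφ, lintegral_const_mul _ (by fun_prop),
          lintegral_add_left measurable_const, lintegral_const, hν]
        ring
  have h2 : m * ∫⁻ a, φ a ∂μ ≤
      m * (∫⁻ b, φ b ∂ν + c * (2 * m + ∫⁻ a, W a ∂μ + ∫⁻ b, W b ∂ν)) := by
    calc m * ∫⁻ a, φ a ∂μ = ∫⁻ a, m * φ a ∂μ := (lintegral_const_mul _ hφ).symm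
      _ ≤ ∫⁻ a, (∫⁻ b, φ b ∂ν + c * (2 * m + m * W a + ∫⁻ b, W b ∂ν)) ∂μ := lintegral_mono h1
      _ = _ := by
        rw [lintegral_add_left measurable_const, lintegral_const_mul _ (by fun_prop),
          lintegral_add_right _ measurable_const, lintegral_add_left measurable_const,
          lintegral_const_mul _ hW, lintegral_const, lintegral_const, lintegral_const, hμ]
        ring
  exact (ENNReal.mul_le_mul_iff_right hm0 hm).1 h2

/-- One-step contraction of the weighted oscillation under a drift condition and a
minorization on the sublevel set of the Lyapunov function `V`. -/
lemma lintegral_le_of_drift_of_minorization {κ : α → Measure α}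
    (hprob : ∀ x, IsProbabilityMeasure (κ x)) {V : α → ℝ≥0∞} (hV : Measurable V)
    {l b ε : ℝ} (hl0 : 0 ≤ l) (hl : l < 1) (hb : 0 < b) (hε0 : 0 < ε) (hε : ε < 1)
    (hdrift : ∀ x, ∫⁻ y, V y ∂κ x ≤ ENNReal.ofReal l * V x + ENNReal.ofReal b)
    {η : Measure α} (hη : η univ = ENNReal.ofReal ε)
    (hminor : ∀ x, V x ≤ ENNReal.ofReal (8 * b / (1 - l)) → η ≤ κ x)
    {φ : α → ℝ≥0∞} (hφ : Measurable φ) {c : ℝ≥0∞}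
    (h : ∀ x y, φ x ≤ φ y + c * (2 + ENNReal.ofReal (ε / (2 * b)) * V x
      + ENNReal.ofReal (ε / (2 * b)) * V y)) (x y : α) :
    ∫⁻ z, φ z ∂κ x ≤ ∫⁻ z, φ z ∂κ y + c * ENNReal.ofReal (max (1 - ε / 2) ((1 + l) / 2)) *
      (2 + ENNReal.ofReal (ε / (2 * b)) * V x + ENNReal.ofReal (ε / (2 * b)) * V y) := by
  set β := ε / (2 * b) with hβ
  have hβ0 : 0 < β := by positivity
  have hβb : 2 * (β * b) = ε := by rw [hβ]; field_simp
  set r := max (1 - ε / 2) ((1 + l) / 2) with hr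
  have hr1 : 1 - ε / 2 ≤ r := le_max_left _ _
  have hr2 : (1 + l) / 2 ≤ r := le_max_right _ _
  have hr0 : 0 < r := by linarith
  have hβV : ∀ x, ∫⁻ z, ENNReal.ofReal β * V z ∂κ x ≤
      ENNReal.ofReal β * (ENNReal.ofReal l * V x + ENNReal.ofReal b) := fun x => by
    rw [lintegral_const_mul _ hV]
    gcongr
    exact hdrift x
  have hone := lintegral_le_lintegral_add_of_oscillation one_ne_zero ENNReal.one_ne_top
    (hprob x).measure_univ (hprob y).measure_univ hφ (W := fun z => ENNReal.ofReal β * V z)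
    (by fun_prop) h
  by_cases hxy : V x = ∞ ∨ V y = ∞
  · by_cases hc : c = 0
    · simpa [hc] using hone
    · have hsum : ENNReal.ofReal β * V x + ENNReal.ofReal β * V y = ∞ := by
        rcases hxy with h | h <;> simp [h, ENNReal.mul_top, hβ0]
      have : c * ENNReal.ofReal r *
          (2 + ENNReal.ofReal β * V x + ENNReal.ofReal β * V y) = ∞ := by
        rw [add_assoc, hsum]
        simp [hc, hr0]
      simp [this]
  obtain ⟨hx, hy⟩ := not_or.1 hxy
  obtain ⟨u, hu0, hu⟩ : ∃ u : ℝ, 0 ≤ u ∧ V x = ENNReal.ofReal u :=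
    ⟨(V x).toReal, ENNReal.toReal_nonneg, (ENNReal.ofReal_toReal hx).symm⟩
  obtain ⟨v, hv0, hv⟩ : ∃ u : ℝ, 0 ≤ u ∧ V y = ENNReal.ofReal u :=
    ⟨(V y).toReal, ENNReal.toReal_nonneg, (ENNReal.ofReal_toReal hy).symm⟩
  have key : ∀ m : ℝ, 0 ≤ m → 2 * m + β * (l * u + b) + β * (l * v + b) ≤
      r * (2 + β * u + β * v) →
      2 * ENNReal.ofReal m + ENNReal.ofReal β * (ENNReal.ofReal l * V x + ENNReal.ofReal b) +
        ENNReal.ofReal β * (ENNReal.ofReal l * V y + ENNReal.ofReal b) ≤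
      ENNReal.ofReal r * (2 + ENNReal.ofReal β * V x + ENNReal.ofReal β * V y) := by
    intro m hm hle
    have e2 : (2 : ℝ≥0∞) = ENNReal.ofReal 2 := by simp
    rw [hu, hv, e2]
    repeat' first
      | rw [← ENNReal.ofReal_mul (by positivity)]
      | rw [← ENNReal.ofReal_add (by positivity) (by positivity)]
    exact ENNReal.ofReal_le_ofReal hle
  have hbu : 0 ≤ β * u := by positivity
  have hbv : 0 ≤ β * v := by positivity
  have hsum : (1 + l) / 2 * (β * u + β * v) ≤ r * (β * u + β * v) := by gcongr
  rw [mul_assoc]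
  by_cases hR : u + v ≤ 8 * b / (1 - l)
  · have hηx : η ≤ κ x := hminor x (by rw [hu]; exact ENNReal.ofReal_le_ofReal (by linarith))
    have hηy : η ≤ κ y := hminor y (by rw [hv]; exact ENNReal.ofReal_le_ofReal (by linarith))
    have : IsFiniteMeasure η := ⟨by rw [hη]; exact ENNReal.ofReal_lt_top⟩
    have hmass : ∀ z, η ≤ κ z → (κ z - η) univ = ENNReal.ofReal (1 - ε) := fun z hz => by
      rw [Measure.sub_apply MeasurableSet.univ hz, (hprob z).measure_univ, hη,
        ENNReal.ofReal_sub _ hε0.le, ENNReal.ofReal_one]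
    have hsplit : ∀ z, η ≤ κ z → ∀ f : α → ℝ≥0∞,
        ∫⁻ a, f a ∂κ z = ∫⁻ a, f a ∂(κ z - η) + ∫⁻ a, f a ∂η := fun z hz f => by
      rw [← lintegral_add_measure, Measure.sub_add_cancel_of_le hz]
    have := lintegral_le_lintegral_add_of_oscillation
      (by simpa using hε) ENNReal.ofReal_ne_top
      (hmass x hηx) (hmass y hηy) hφ (W := fun z => ENNReal.ofReal β * V z) (by fun_prop) h
    rw [hsplit x hηx φ, hsplit y hηy φ, add_right_comm]
    gcongr
    refine this.trans ?_
    gcongr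
    refine le_trans ?_ (key (1 - ε) (by linarith) (by nlinarith))
    gcongr
    · exact (lintegral_mono' Measure.sub_le le_rfl).trans (hβV x)
    · exact (lintegral_mono' Measure.sub_le le_rfl).trans (hβV y)
  · refine hone.trans ?_
    gcongr
    have hR' : 8 * b ≤ (1 - l) * (u + v) := by
      rw [not_le, div_lt_iff₀ (by linarith)] at hR
      linarith
    have hR2 : β * (8 * b) ≤ β * ((1 - l) * (u + v)) := by gcongr
    refine le_trans ?_ (key 1 zero_le_one (by nlinarith))
    rw [ENNReal.ofReal_one]
    gcongr
    · exact hβV x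
    · exact hβV y

/-- Geometric contraction of the iterates under drift and minorization (Harris' theorem). -/
lemma lintegral_kiter_le_of_drift_of_minorization {κ : α → Measure α} (hκ : Measurable κ)
    (hprob : ∀ x, IsProbabilityMeasure (κ x)) {V : α → ℝ≥0∞} (hV : Measurable V)
    {l b ε : ℝ} (hl0 : 0 ≤ l) (hl : l < 1) (hb : 0 < b) (hε0 : 0 < ε) (hε : ε < 1)
    (hdrift : ∀ x, ∫⁻ y, V y ∂κ x ≤ ENNReal.ofReal l * V x + ENNReal.ofReal b)
    {η : Measure α} (hη : η univ = ENNReal.ofReal ε)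
    (hminor : ∀ x, V x ≤ ENNReal.ofReal (8 * b / (1 - l)) → η ≤ κ x)
    (n : ℕ) {φ : α → ℝ≥0∞} (hφ : Measurable φ) {c : ℝ≥0∞}
    (h : ∀ x y, φ x ≤ φ y + c * (2 + ENNReal.ofReal (ε / (2 * b)) * V x
      + ENNReal.ofReal (ε / (2 * b)) * V y)) (x y : α) :
    ∫⁻ z, φ z ∂kiter κ n x ≤ ∫⁻ z, φ z ∂kiter κ n y +
      c * ENNReal.ofReal (max (1 - ε / 2) ((1 + l) / 2)) ^ n *
      (2 + ENNReal.ofReal (ε / (2 * b)) * V x + ENNReal.ofReal (ε / (2 * b)) * V y) := by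
  induction n generalizing φ c with
  | zero => simpa [kiter, lintegral_dirac' _ hφ] using h x y
  | succ n ih =>
    simp only [kiter]
    rw [Measure.lintegral_bind hκ.aemeasurable hφ.aemeasurable,
      Measure.lintegral_bind hκ.aemeasurable hφ.aemeasurable, pow_succ', ← mul_assoc]
    exact ih ((Measure.measurable_lintegral hφ).comp hκ)
      (lintegral_le_of_drift_of_minorization hprob hV hl0 hl hb hε0 hε hdrift hη hminor hφ h)

lemma isProbabilityMeasure_kiter {κ : α → Measure α} (hκ : Measurable κ)
    (hprob : ∀ x, IsProbabilityMeasure (κ x)) (n : ℕ) (x : α) :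
    IsProbabilityMeasure (kiter κ n x) := by
  induction n with
  | zero => simp only [kiter]; infer_instance
  | succ n ih =>
    refine ⟨?_⟩
    simp only [kiter]
    rw [Measure.bind_apply MeasurableSet.univ hκ.aemeasurable]
    simp [(hprob _).measure_univ]

end Harris

lemma gaussMeasure_eq_gaussianReal {σ : ℝ} (hσ : 0 < σ) :
    gaussMeasure σ = gaussianReal 0 (σ ^ 2).toNNReal := by
  have hv : (σ ^ 2).toNNReal ≠ 0 := by simpa using hσ.ne'
  rw [gaussianReal_of_var_ne_zero _ hv]
  have h : ∀ z, gaussianPDF 0 (σ ^ 2).toNNReal z = ENNReal.ofReal (gaussDensity σ z) := fun z => by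
    rw [gaussianPDF, gaussianPDFReal, gaussDensity, Real.coe_toNNReal _ (sq_nonneg σ), sub_zero]
  rw [gaussMeasure, funext h]

lemma measurable_gaussDensity (σ : ℝ) : Measurable (gaussDensity σ) := by
  unfold gaussDensity
  fun_prop

lemma measurable_mixDensity (σ : ℝ) : Measurable (mixDensity σ) := by
  have := measurable_gaussDensity σ
  unfold mixDensity
  fun_prop

lemma gaussDensity_pos {σ : ℝ} (hσ : 0 < σ) (x : ℝ) : 0 < gaussDensity σ x := by
  unfold gaussDensity
  positivity

lemma mixDensity_pos {σ : ℝ} (hσ : 0 < σ) (x : ℝ) : 0 < mixDensity σ x := by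
  have h1 := gaussDensity_pos hσ (x + 1)
  have h2 := gaussDensity_pos hσ (x - 1)
  unfold mixDensity
  positivity

/-- Metropolis acceptance probability of a move from `x` to `y`. -/
noncomputable def acceptProb (σ x y : ℝ) : ℝ := min 1 (mixDensity σ y / mixDensity σ x)

lemma acceptProb_nonneg {σ : ℝ} (hσ : 0 < σ) (x y : ℝ) : 0 ≤ acceptProb σ x y :=
  le_min zero_le_one (div_pos (mixDensity_pos hσ y) (mixDensity_pos hσ x)).le

lemma acceptProb_le_one (σ x y : ℝ) : acceptProb σ x y ≤ 1 := min_le_left _ _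

lemma measurable_acceptProb_right (σ x : ℝ) : Measurable (acceptProb σ x) := by
  have := measurable_mixDensity σ
  unfold acceptProb
  fun_prop

lemma isProbabilityMeasure_gaussMeasure {σ : ℝ} (hσ : 0 < σ) :
    IsProbabilityMeasure (gaussMeasure σ) := by
  rw [gaussMeasure_eq_gaussianReal hσ]
  infer_instance

lemma ofReal_one_sub_integral_acceptProb {σ : ℝ} (hσ : 0 < σ) (x : ℝ) :
    ENNReal.ofReal (1 - ∫ z, acceptProb σ x (x + z) * gaussDensity σ z) =
      ∫⁻ z, ENNReal.ofReal (1 - acceptProb σ x (x + z)) ∂gaussMeasure σ := by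
  have := isProbabilityMeasure_gaussMeasure hσ
  have hmeas : Measurable fun z => acceptProb σ x (x + z) :=
    (measurable_acceptProb_right σ x).comp (measurable_const_add x)
  have hint : Integrable (fun z => acceptProb σ x (x + z)) (gaussMeasure σ) :=
    Integrable.of_bound hmeas.aestronglyMeasurable 1 (ae_of_all _ fun z => by
      rw [Real.norm_of_nonneg (acceptProb_nonneg hσ _ _)]
      exact acceptProb_le_one _ _ _)
  have heq : ∫ z, acceptProb σ x (x + z) * gaussDensity σ z =
      ∫ z, acceptProb σ x (x + z) ∂gaussMeasure σ := by
    rw [gaussMeasure, integral_withDensity_eq_integral_toReal_smul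
      (measurable_gaussDensity σ).ennreal_ofReal (ae_of_all _ fun _ => ENNReal.ofReal_lt_top)]
    refine integral_congr_ae (ae_of_all _ fun z => ?_)
    simp [ENNReal.toReal_ofReal (gaussDensity_pos hσ z).le, mul_comm]
  have hsub := ofReal_integral_eq_lintegral_ofReal ((integrable_const (1 : ℝ)).sub hint)
    (ae_of_all _ fun z => sub_nonneg.2 (acceptProb_le_one _ _ _))
  simp only [Pi.sub_apply] at hsub
  rw [heq, ← hsub, integral_sub (integrable_const 1) hint]
  simp

lemma lintegral_rwmKernel {σ : ℝ} (hσ : 0 < σ) (x : ℝ) {f : ℝ → ℝ≥0∞} (hf : Measurable f) :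
    ∫⁻ y, f y ∂rwmKernel σ x = ∫⁻ z, (ENNReal.ofReal (acceptProb σ x (x + z)) * f (x + z) +
      ENNReal.ofReal (1 - acceptProb σ x (x + z)) * f x) ∂gaussMeasure σ := by
  have hmeas := measurable_acceptProb_right σ x
  change ∫⁻ y, f y ∂(((gaussMeasure σ).map (fun z => x + z)).withDensity
    (fun y => ENNReal.ofReal (acceptProb σ x y)) + (ENNReal.ofReal
      (1 - ∫ z, acceptProb σ x (x + z) * gaussDensity σ z)) • Measure.dirac x) = _
  rw [lintegral_add_measure,
    lintegral_withDensity_eq_lintegral_mul _ hmeas.ennreal_ofReal hf,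
    lintegral_map (hmeas.ennreal_ofReal.mul hf) (measurable_const_add x),
    lintegral_smul_measure, lintegral_dirac' _ hf, ofReal_one_sub_integral_acceptProb hσ x, lintegral_add_left (by fun_prop),
    lintegral_mul_const _ (by fun_prop)]
  rfl

lemma lintegral_rwmKernelHat {σ : ℝ} (hσ : 0 < σ) (x : ℝ) {f : ℝ → ℝ≥0∞} (hf : Measurable f) :
    ∫⁻ y, f y ∂rwmKernelHat σ x = ∫⁻ z, (ENNReal.ofReal (acceptProb σ x (x + z)) *
      (if x + z < 0 then f (x + z) else f x) +
      ENNReal.ofReal (1 - acceptProb σ x (x + z)) * f x) ∂gaussMeasure σ := by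
  have hF : Measurable fun y => if y < 0 then f y else f x :=
    Measurable.ite measurableSet_Iio hf measurable_const
  have h := lintegral_rwmKernel hσ x hF
  simp only [ite_self] at h
  rw [rwmKernelHat, lintegral_add_measure, lintegral_smul_measure, lintegral_dirac' _ hf, ← h,
    ← lintegral_add_compl (fun y => if y < 0 then f y else f x) (measurableSet_Iio (a := (0 : ℝ))),
    compl_Iio]
  congr 1
  · exact setLIntegral_congr_fun measurableSet_Iio fun y hy => by simp [mem_Iio.1 hy]
  · rw [setLIntegral_congr_fun (g := fun _ => f x) measurableSet_Ici fun y hy => by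
      simp [not_lt.2 (mem_Ici.1 hy)], setLIntegral_const, smul_eq_mul, mul_comm]

lemma measurable_rwmKernelHat {σ : ℝ} (hσ : 0 < σ) : Measurable (rwmKernelHat σ) := by
  have := isProbabilityMeasure_gaussMeasure hσ
  refine Measure.measurable_of_measurable_coe _ fun A hA => ?_
  have hf : Measurable (A.indicator (1 : ℝ → ℝ≥0∞)) := measurable_one.indicator hA
  simp_rw [← lintegral_indicator_one hA, lintegral_rwmKernelHat hσ _ hf]
  have hmix := measurable_mixDensity σ
  have hacc : Measurable fun p : ℝ × ℝ => acceptProb σ p.1 (p.1 + p.2) := by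
    unfold acceptProb
    fun_prop
  have hF : Measurable fun p : ℝ × ℝ =>
      if p.1 + p.2 < 0 then A.indicator (1 : ℝ → ℝ≥0∞) (p.1 + p.2) else A.indicator 1 p.1 :=
    Measurable.ite (measurableSet_lt (by fun_prop) (by fun_prop)) (by fun_prop) (by fun_prop)
  exact Measurable.lintegral_prod_right' (f := fun p : ℝ × ℝ =>
    ENNReal.ofReal (acceptProb σ p.1 (p.1 + p.2)) *
      (if p.1 + p.2 < 0 then A.indicator (1 : ℝ → ℝ≥0∞) (p.1 + p.2) else A.indicator 1 p.1) +
      ENNReal.ofReal (1 - acceptProb σ p.1 (p.1 + p.2)) * A.indicator 1 p.1) (by fun_prop)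

lemma isProbabilityMeasure_rwmKernelHat {σ : ℝ} (hσ : 0 < σ) (x : ℝ) :
    IsProbabilityMeasure (rwmKernelHat σ x) := by
  have := isProbabilityMeasure_gaussMeasure hσ
  refine ⟨?_⟩
  rw [← lintegral_one, lintegral_rwmKernelHat hσ x measurable_const]
  simp only [ite_self, mul_one]
  simp_rw [← ENNReal.ofReal_add (acceptProb_nonneg hσ _ _)
    (sub_nonneg.2 (acceptProb_le_one _ _ _))]
  simp

/-- With probability at least `0.45`, a Gaussian increment is positive and comparable to `σ`. -/
lemma gaussMeasure_compl_Icc_le {σ : ℝ} (hσ : 0 < σ) :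
    gaussMeasure σ (Icc (σ / 100) (10 * σ))ᶜ ≤ ENNReal.ofReal (11 / 20) := by
  have hprob := isProbabilityMeasure_gaussMeasure hσ
  have hneg : gaussMeasure σ (Iio 0) ≤ ENNReal.ofReal (1 / 2) := by
    have hsymm : gaussMeasure σ (Ioi 0) = gaussMeasure σ (Iio 0) := by
      have h := gaussianReal_map_neg (μ := 0) (v := (σ ^ 2).toNNReal)
      rw [neg_zero, ← gaussMeasure_eq_gaussianReal hσ] at h
      conv_lhs => rw [← h, Measure.map_apply measurable_neg measurableSet_Ioi]
      simp
    have h2 : gaussMeasure σ (Iio 0) + gaussMeasure σ (Iio 0) ≤ 1 := by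
      nth_rewrite 2 [← hsymm]
      rw [← measure_union (by
        rw [Set.disjoint_left]
        intro z hz hz'
        exact lt_asymm (mem_Iio.1 hz) (mem_Ioi.1 hz')) measurableSet_Ioi]
      exact prob_le_one
    rw [← two_mul] at h2
    rw [one_div, ENNReal.ofReal_inv_of_pos two_pos]
    rw [ENNReal.le_inv_iff_mul_le]
    simpa [mul_comm] using h2
  have hsmall : gaussMeasure σ (Ico 0 (σ / 100)) ≤ ENNReal.ofReal (1 / 100) := by
    have hd : ∀ z, gaussDensity σ z ≤ 1 / σ := fun z => by
      have h1 : σ ≤ √(2 * Real.pi * σ ^ 2) := by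
        refine Real.le_sqrt_of_sq_le ?_
        nlinarith [Real.pi_gt_three, sq_nonneg σ]
      have h2 : Real.exp (-(z ^ 2) / (2 * σ ^ 2)) ≤ 1 := by
        rw [Real.exp_le_one_iff, neg_div]
        exact neg_nonpos.2 (by positivity)
      calc gaussDensity σ z ≤ σ⁻¹ * 1 := by unfold gaussDensity; gcongr
        _ = 1 / σ := by ring
    rw [gaussMeasure, withDensity_apply _ measurableSet_Ico]
    calc ∫⁻ z in Ico 0 (σ / 100), ENNReal.ofReal (gaussDensity σ z)
        ≤ ∫⁻ z in Ico 0 (σ / 100), ENNReal.ofReal (1 / σ) :=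
          lintegral_mono fun z => ENNReal.ofReal_le_ofReal (hd z)
      _ = ENNReal.ofReal (1 / 100) := by
        rw [setLIntegral_const, Real.volume_Ico, ← ENNReal.ofReal_mul (by positivity)]
        congr 1
        field_simp
        ring
  have hlarge : gaussMeasure σ (Ioi (10 * σ)) ≤ ENNReal.ofReal (1 / 100) := by
    have h := meas_ge_le_variance_div_sq (μ := gaussianReal 0 (σ ^ 2).toNNReal)
      (memLp_id_gaussianReal 2) (c := 10 * σ) (by positivity)
    rw [variance_id_gaussianReal] at h
    rw [gaussMeasure_eq_gaussianReal hσ]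
    refine (measure_mono fun z hz => ?_).trans (h.trans_eq ?_)
    · simp only [mem_ofPred_eq, id_eq, integral_id_gaussianReal, sub_zero]
      exact (mem_Ioi.1 hz).le.trans (le_abs_self z)
    · rw [Real.coe_toNNReal _ (sq_nonneg σ)]
      congr 1
      field_simp
      norm_num
  have hsub : (Icc (σ / 100) (10 * σ))ᶜ ⊆ Iio 0 ∪ Ico 0 (σ / 100) ∪ Ioi (10 * σ) := by
    intro z hz
    simp only [mem_compl_iff, mem_Icc, not_and_or, not_le] at hz
    rcases hz with hz | hz
    · rcases lt_or_ge z 0 with h | h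
      · exact Or.inl (Or.inl h)
      · exact Or.inl (Or.inr ⟨h, hz⟩)
    · exact Or.inr hz
  calc gaussMeasure σ (Icc (σ / 100) (10 * σ))ᶜ
      ≤ gaussMeasure σ (Iio 0) + gaussMeasure σ (Ico 0 (σ / 100)) +
        gaussMeasure σ (Ioi (10 * σ)) := (measure_mono hsub).trans
          ((measure_union_le _ _).trans (by gcongr; exact measure_union_le _ _))
    _ ≤ ENNReal.ofReal (1 / 2) + ENNReal.ofReal (1 / 100) + ENNReal.ofReal (1 / 100) := by gcongr
    _ ≤ ENNReal.ofReal (11 / 20) := by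
      rw [← ENNReal.ofReal_add (by norm_num) (by norm_num),
        ← ENNReal.ofReal_add (by norm_num) (by norm_num)]
      exact ENNReal.ofReal_le_ofReal (by norm_num)

lemma gaussMeasure_compl_Icc_neg_le {σ : ℝ} (hσ : 0 < σ) :
    gaussMeasure σ (Icc (-(10 * σ)) (-(σ / 100)))ᶜ ≤ ENNReal.ofReal (11 / 20) := by
  refine (gaussMeasure_compl_Icc_le hσ).trans_eq' ?_
  have h := gaussianReal_map_neg (μ := 0) (v := (σ ^ 2).toNNReal)
  rw [neg_zero, ← gaussMeasure_eq_gaussianReal hσ] at h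
  conv_lhs => rw [← h, Measure.map_apply measurable_neg measurableSet_Icc.compl]
  simp

/-- The mixture density `f_σ` up to its normalising constant. -/
noncomputable def mixWeight (σ x : ℝ) : ℝ :=
  Real.exp (-((x + 1) ^ 2) / (2 * σ ^ 2)) + Real.exp (-((x - 1) ^ 2) / (2 * σ ^ 2))

lemma mixWeight_pos (σ x : ℝ) : 0 < mixWeight σ x := by
  unfold mixWeight
  positivity

lemma mixDensity_eq (σ x : ℝ) :
    mixDensity σ x = 1 / 2 * (√(2 * Real.pi * σ ^ 2))⁻¹ * mixWeight σ x := by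
  unfold mixDensity gaussDensity mixWeight
  ring

lemma acceptProb_eq {σ : ℝ} (hσ : 0 < σ) (x y : ℝ) :
    acceptProb σ x y = min 1 (mixWeight σ y / mixWeight σ x) := by
  have hc : 1 / 2 * (√(2 * Real.pi * σ ^ 2))⁻¹ ≠ 0 := by positivity
  rw [acceptProb, mixDensity_eq, mixDensity_eq, mul_div_mul_left _ _ hc]

/-- The Lyapunov function `f_σ ^ (-1/2)` (up to normalisation) on `(-∞, 0)`. -/
noncomputable def lyapunov (σ x : ℝ) : ℝ≥0∞ :=
  if x < 0 then ENNReal.ofReal (1 / √(mixWeight σ x)) else ∞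

lemma measurable_lyapunov (σ : ℝ) : Measurable (lyapunov σ) := by
  unfold lyapunov mixWeight
  exact Measurable.ite measurableSet_Iio (by fun_prop) measurable_const

lemma lyapunov_of_neg {σ x : ℝ} (hx : x < 0) :
    lyapunov σ x = ENNReal.ofReal (1 / √(mixWeight σ x)) := if_pos hx

lemma lyapunov_le_exp {σ x : ℝ} (hx : x < 0) :
    lyapunov σ x ≤ ENNReal.ofReal (Real.exp ((x + 1) ^ 2 / (4 * σ ^ 2))) := by
  rw [lyapunov_of_neg hx]
  refine ENNReal.ofReal_le_ofReal ?_
  have h1 : Real.exp (-((x + 1) ^ 2) / (2 * σ ^ 2)) ≤ mixWeight σ x :=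
    le_add_of_nonneg_right (Real.exp_pos _).le
  have h2 : Real.exp (-((x + 1) ^ 2 / (4 * σ ^ 2))) ≤ √(mixWeight σ x) := by
    refine Real.le_sqrt_of_sq_le (le_trans (le_of_eq ?_) h1)
    rw [← Real.exp_nat_mul]
    congr 1
    push_cast
    ring
  calc 1 / √(mixWeight σ x) ≤ 1 / Real.exp (-((x + 1) ^ 2 / (4 * σ ^ 2))) := by gcongr
    _ = _ := by rw [Real.exp_neg, one_div, inv_inv]

lemma min_one_sq_div_add_le {s : ℝ} (hs : 0 < s) :
    min 1 (s ^ 2) / s + (1 - min 1 (s ^ 2)) ≤ 5 / 4 := by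
  rcases le_total 1 s with h | h
  · rw [min_eq_left (by nlinarith)]
    have : 1 / s ≤ 1 := (div_le_one hs).2 h
    linarith
  · rw [min_eq_right (by nlinarith), show s ^ 2 / s = s by field_simp]
    nlinarith [sq_nonneg (s - 1 / 2)]

lemma metropolis_lyapunov_eq {σ : ℝ} (hσ : 0 < σ) {x y : ℝ} (hx : x < 0) (hy : y < 0) :
    ENNReal.ofReal (acceptProb σ x y) * lyapunov σ y +
      ENNReal.ofReal (1 - acceptProb σ x y) * lyapunov σ x =
    ENNReal.ofReal (min 1 ((√(mixWeight σ y) / √(mixWeight σ x)) ^ 2) /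
      (√(mixWeight σ y) / √(mixWeight σ x)) +
      (1 - min 1 ((√(mixWeight σ y) / √(mixWeight σ x)) ^ 2))) * lyapunov σ x := by
  have hp := Real.sqrt_pos.2 (mixWeight_pos σ x)
  have hq := Real.sqrt_pos.2 (mixWeight_pos σ y)
  have h0 := acceptProb_nonneg hσ x y
  have h1 := sub_nonneg.2 (acceptProb_le_one σ x y)
  have hα : min 1 ((√(mixWeight σ y) / √(mixWeight σ x)) ^ 2) = acceptProb σ x y := by
    rw [acceptProb_eq hσ, div_pow, Real.sq_sqrt (mixWeight_pos σ y).le,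
      Real.sq_sqrt (mixWeight_pos σ x).le]
  rw [hα, lyapunov_of_neg hx, lyapunov_of_neg hy, ← ENNReal.ofReal_mul h0,
    ← ENNReal.ofReal_mul h1, ← ENNReal.ofReal_add (by positivity) (by positivity),
    ← ENNReal.ofReal_mul (by positivity)]
  congr 1
  field_simp

lemma metropolis_lyapunov_le {σ : ℝ} (hσ : 0 < σ) {x : ℝ} (hx : x < 0) (y : ℝ) :
    ENNReal.ofReal (acceptProb σ x y) * (if y < 0 then lyapunov σ y else lyapunov σ x) +
      ENNReal.ofReal (1 - acceptProb σ x y) * lyapunov σ x ≤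
    ENNReal.ofReal (5 / 4) * lyapunov σ x := by
  split_ifs with hy
  · rw [metropolis_lyapunov_eq hσ hx hy]
    gcongr
    exact min_one_sq_div_add_le
      (div_pos (Real.sqrt_pos.2 (mixWeight_pos σ y)) (Real.sqrt_pos.2 (mixWeight_pos σ x)))
  · rw [← add_mul, ← ENNReal.ofReal_add (acceptProb_nonneg hσ x y)
      (sub_nonneg.2 (acceptProb_le_one σ x y))]
    gcongr
    norm_num

lemma metropolis_lyapunov_le_of_mixWeight_le {σ : ℝ} (hσ : 0 < σ) {x y : ℝ} (hx : x < 0)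
    (hy : y < 0) (h : 36 * mixWeight σ x ≤ mixWeight σ y) :
    ENNReal.ofReal (acceptProb σ x y) * (if y < 0 then lyapunov σ y else lyapunov σ x) +
      ENNReal.ofReal (1 - acceptProb σ x y) * lyapunov σ x ≤
    ENNReal.ofReal (1 / 6) * lyapunov σ x := by
  rw [if_pos hy, metropolis_lyapunov_eq hσ hx hy]
  gcongr
  have hp := Real.sqrt_pos.2 (mixWeight_pos σ x)
  have hs : 6 ≤ √(mixWeight σ y) / √(mixWeight σ x) := by
    rw [le_div_iff₀ hp]
    refine Real.le_sqrt_of_sq_le ?_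
    rw [mul_pow, Real.sq_sqrt (mixWeight_pos σ x).le]
    linarith
  rw [min_eq_left (by nlinarith), sub_self, add_zero]
  exact one_div_le_one_div_of_le (by norm_num) hs

lemma lintegral_lyapunov_le {σ : ℝ} (hσ : 0 < σ) {x : ℝ} (hx : x < 0) :
    ∫⁻ y, lyapunov σ y ∂rwmKernelHat σ x ≤ ENNReal.ofReal (5 / 4) * lyapunov σ x := by
  have := isProbabilityMeasure_gaussMeasure hσ
  rw [lintegral_rwmKernelHat hσ x (measurable_lyapunov σ)]
  refine (lintegral_mono fun z => metropolis_lyapunov_le hσ hx (x + z)).trans ?_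
  simp

lemma lintegral_lyapunov_le_of_inward {σ : ℝ} (hσ : 0 < σ) {x : ℝ} (hx : x < 0) {G : Set ℝ}
    (hG : MeasurableSet G) (hGc : gaussMeasure σ Gᶜ ≤ ENNReal.ofReal (11 / 20))
    (h : ∀ z ∈ G, x + z < 0 ∧ 36 * mixWeight σ x ≤ mixWeight σ (x + z)) :
    ∫⁻ y, lyapunov σ y ∂rwmKernelHat σ x ≤ ENNReal.ofReal (9 / 10) * lyapunov σ x := by
  have := isProbabilityMeasure_gaussMeasure hσ
  rw [lintegral_rwmKernelHat hσ x (measurable_lyapunov σ), ← lintegral_add_compl _ hG]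
  calc _ ≤ ∫⁻ _ in G, ENNReal.ofReal (1 / 6) * lyapunov σ x ∂gaussMeasure σ +
        ∫⁻ _ in Gᶜ, ENNReal.ofReal (5 / 4) * lyapunov σ x ∂gaussMeasure σ := by
        refine add_le_add (setLIntegral_mono measurable_const fun z hz => ?_)
          (lintegral_mono fun z => metropolis_lyapunov_le hσ hx (x + z))
        exact metropolis_lyapunov_le_of_mixWeight_le hσ hx (h z hz).1 (h z hz).2
    _ = (ENNReal.ofReal (1 / 6) * gaussMeasure σ G +
        ENNReal.ofReal (5 / 4) * gaussMeasure σ Gᶜ) * lyapunov σ x := by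
        rw [setLIntegral_const, setLIntegral_const]
        ring
    _ ≤ (ENNReal.ofReal (1 / 6) * 1 + ENNReal.ofReal (5 / 4) * ENNReal.ofReal (11 / 20)) *
        lyapunov σ x := by
        gcongr
        exact prob_le_one
    _ ≤ _ := by
        gcongr
        rw [mul_one, ← ENNReal.ofReal_mul (by norm_num),
          ← ENNReal.ofReal_add (by norm_num) (by norm_num)]
        exact ENNReal.ofReal_le_ofReal (by norm_num)

lemma mul_exp_neg_sq_le {σ : ℝ} (hσ : 0 < σ) {a b : ℝ} (h : 10 * σ ^ 2 ≤ a ^ 2 - b ^ 2) :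
    72 * Real.exp (-(a ^ 2) / (2 * σ ^ 2)) ≤ Real.exp (-(b ^ 2) / (2 * σ ^ 2)) := by
  have h5 : (72 : ℝ) ≤ Real.exp 5 := by
    have h1 : (2.7 : ℝ) ≤ Real.exp 1 := by linarith [Real.exp_one_gt_d9]
    calc (72 : ℝ) ≤ 2.7 ^ 5 := by norm_num
      _ ≤ Real.exp 1 ^ 5 := by gcongr
      _ = Real.exp 5 := by rw [← Real.exp_nat_mul]; norm_num
  calc 72 * Real.exp (-(a ^ 2) / (2 * σ ^ 2))
      ≤ Real.exp 5 * Real.exp (-(a ^ 2) / (2 * σ ^ 2)) := by gcongr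
    _ = Real.exp (5 + -(a ^ 2) / (2 * σ ^ 2)) := (Real.exp_add _ _).symm
    _ ≤ _ := by
      rw [Real.exp_le_exp, le_div_iff₀ (by positivity), add_mul, div_mul_cancel₀ _ (by positivity)]
      linarith

lemma mixWeight_le_of_neg {σ x : ℝ} (hx : x < 0) :
    mixWeight σ x ≤ 2 * Real.exp (-((x + 1) ^ 2) / (2 * σ ^ 2)) := by
  have : Real.exp (-((x - 1) ^ 2) / (2 * σ ^ 2)) ≤ Real.exp (-((x + 1) ^ 2) / (2 * σ ^ 2)) := by
    rw [Real.exp_le_exp]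
    gcongr ?_ / _
    nlinarith
  unfold mixWeight
  linarith

lemma lintegral_lyapunov_drift {σ : ℝ} (hσ : 0 < σ) (x : ℝ) :
    ∫⁻ y, lyapunov σ y ∂rwmKernelHat σ x ≤ ENNReal.ofReal (9 / 10) * lyapunov σ x +
      ENNReal.ofReal (5 / 4 * Real.exp (505 ^ 2 / 4)) := by
  rcases lt_or_ge x 0 with hx | hx
  swap
  · have : lyapunov σ x = ∞ := if_neg hx.not_gt
    simp [this, ENNReal.mul_top]
  rcases lt_or_ge x (-1 - 505 * σ) with hl | hl
  · refine (lintegral_lyapunov_le_of_inward hσ hx measurableSet_Icc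
      (gaussMeasure_compl_Icc_le hσ) ?_).trans le_self_add
    rintro z ⟨hz1, hz2⟩
    refine ⟨by linarith, ?_⟩
    have h1 := mul_exp_neg_sq_le hσ (a := x + 1) (b := x + z + 1) (by nlinarith)
    have h2 := mul_exp_neg_sq_le hσ (a := x - 1) (b := x + z - 1) (by nlinarith)
    have h3 := mixWeight_pos σ x
    unfold mixWeight at h3 ⊢
    linarith
  rcases lt_or_ge (-1 + 505 * σ) x with hr | hr
  · refine (lintegral_lyapunov_le_of_inward hσ hx measurableSet_Icc
      (gaussMeasure_compl_Icc_neg_le hσ) ?_).trans le_self_add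
    rintro z ⟨hz1, hz2⟩
    refine ⟨by linarith, ?_⟩
    have h1 := mul_exp_neg_sq_le hσ (a := x + 1) (b := x + z + 1) (by nlinarith)
    have h2 : Real.exp (-((x + z + 1) ^ 2) / (2 * σ ^ 2)) ≤ mixWeight σ (x + z) :=
      le_add_of_nonneg_right (Real.exp_pos _).le
    linarith [mixWeight_le_of_neg (σ := σ) hx]
  · refine (lintegral_lyapunov_le hσ hx).trans (le_trans ?_ le_add_self)
    rw [ENNReal.ofReal_mul (by norm_num)]
    gcongr
    refine (lyapunov_le_exp hx).trans (ENNReal.ofReal_le_ofReal ?_)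
    rw [Real.exp_le_exp, div_le_div_iff₀ (by positivity) (by positivity)]
    have : (x + 1) ^ 2 ≤ (505 * σ) ^ 2 := sq_le_sq' (by linarith) (by linarith)
    linarith

/-- Lower bound on the accepted-move density near the mode `-1`, from a sublevel set of the
Lyapunov function. -/
lemma le_acceptProb_mul_gaussDensity {σ : ℝ} (hσ : 0 < σ) {R : ℝ} (hR : 0 < R) {x y : ℝ}
    (hx : x < 0) (hV : lyapunov σ x ≤ ENNReal.ofReal R) (hy : y ∈ Icc (-1 - σ) (-1 + σ)) :
    Real.exp (-(3 / 2)) / (8 * √(2 * Real.pi) * R ^ 4) / σ ≤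
      acceptProb σ x y * gaussDensity σ (y - x) := by
  set E := Real.exp (-((x + 1) ^ 2) / (2 * σ ^ 2)) with hE
  have hy2 : (y + 1) ^ 2 ≤ σ ^ 2 := sq_le_sq' (by linarith [hy.1]) (by linarith [hy.2])
  have hgx : mixWeight σ x ≤ 2 * E := mixWeight_le_of_neg hx
  have hE1 : E ≤ 1 := by
    rw [hE, Real.exp_le_one_iff, neg_div]
    exact neg_nonpos.2 (by positivity)
  have hE2 : 1 / (2 * R ^ 2) ≤ E := by
    rw [lyapunov_of_neg hx, ENNReal.ofReal_le_ofReal_iff hR.le,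
      div_le_iff₀ (Real.sqrt_pos.2 (mixWeight_pos σ x))] at hV
    have h1 : 1 ≤ (R * √(mixWeight σ x)) ^ 2 := one_le_pow₀ hV
    rw [mul_pow, Real.sq_sqrt (mixWeight_pos σ x).le] at h1
    rw [div_le_iff₀ (by positivity)]
    nlinarith [sq_nonneg R]
  have hα : Real.exp (-(1 / 2)) / 2 ≤ acceptProb σ x y := by
    rw [acceptProb_eq hσ]
    have hgy : Real.exp (-(1 / 2)) ≤ mixWeight σ y := by
      refine le_trans ?_ (le_add_of_nonneg_right (Real.exp_pos _).le)
      rw [Real.exp_le_exp, neg_div, neg_le_neg_iff, div_le_iff₀ (by positivity)]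
      linarith
    refine le_min ?_ ?_
    · have : Real.exp (-(1 / 2)) ≤ 1 := Real.exp_le_one_iff.2 (by norm_num)
      linarith
    · exact div_le_div₀ (mixWeight_pos σ y).le hgy (mixWeight_pos σ x) (by linarith)
  have hφ : (√(2 * Real.pi) * σ)⁻¹ * (Real.exp (-1) * (1 / (2 * R ^ 2)) ^ 2) ≤
      gaussDensity σ (y - x) := by
    unfold gaussDensity
    rw [Real.sqrt_mul (by positivity : 0 ≤ 2 * Real.pi) (σ ^ 2), Real.sqrt_sq hσ.le]
    gcongr
    calc Real.exp (-1) * (1 / (2 * R ^ 2)) ^ 2 ≤ Real.exp (-1) * E ^ 2 := by gcongr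
      _ = Real.exp (-1 + -((x + 1) ^ 2) / σ ^ 2) := by
        rw [hE, ← Real.exp_nat_mul, ← Real.exp_add]
        congr 1
        push_cast
        field_simp
      _ ≤ _ := by
        rw [Real.exp_le_exp, le_div_iff₀ (by positivity), add_mul,
          show -((x + 1) ^ 2) / σ ^ 2 * (2 * σ ^ 2) = -2 * (x + 1) ^ 2 by field_simp]
        nlinarith [sq_nonneg ((y + 1) + (x + 1))]
  calc Real.exp (-(3 / 2)) / (8 * √(2 * Real.pi) * R ^ 4) / σ
      = Real.exp (-(1 / 2)) / 2 *
        ((√(2 * Real.pi) * σ)⁻¹ * (Real.exp (-1) * (1 / (2 * R ^ 2)) ^ 2)) := by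
        rw [show (-(3 / 2) : ℝ) = -(1 / 2) + -1 by norm_num, Real.exp_add]
        field_simp
        norm_num
    _ ≤ _ := by gcongr; exact acceptProb_nonneg hσ x y

lemma smul_restrict_le_rwmKernelHat {σ : ℝ} (hσ : 0 < σ) (hσ1 : σ < 1) {x c : ℝ}
    (h : ∀ y ∈ Icc (-1 - σ) (-1 + σ), c ≤ acceptProb σ x y * gaussDensity σ (y - x)) :
    ENNReal.ofReal c • volume.restrict (Icc (-1 - σ) (-1 + σ)) ≤ rwmKernelHat σ x := by
  refine Measure.le_iff.2 fun A hA => ?_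
  set J := Icc (-1 - σ) (-1 + σ) with hJ
  have hAJ : MeasurableSet (A ∩ J) := hA.inter measurableSet_Icc
  have hφ := measurable_gaussDensity σ
  have hα := measurable_acceptProb_right σ x
  have hind : Measurable (A.indicator (1 : ℝ → ℝ≥0∞)) := measurable_one.indicator hA
  have hindJ : Measurable ((A ∩ J).indicator (1 : ℝ → ℝ≥0∞)) := measurable_one.indicator hAJ
  rw [Measure.smul_apply, Measure.restrict_apply hA, smul_eq_mul, ← lintegral_indicator_one hAJ,
    ← lintegral_indicator_one hA, lintegral_rwmKernelHat hσ x hind]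
  calc ENNReal.ofReal c * ∫⁻ y, (A ∩ J).indicator 1 y
      = ∫⁻ z, ENNReal.ofReal c * (A ∩ J).indicator 1 (x + z) := by
        rw [← lintegral_const_mul _ hindJ]
        exact (lintegral_add_left_eq_self
          (fun y => ENNReal.ofReal c * (A ∩ J).indicator 1 y) x).symm
    _ ≤ ∫⁻ z, ENNReal.ofReal (gaussDensity σ z) *
        (ENNReal.ofReal (acceptProb σ x (x + z)) * (A ∩ J).indicator 1 (x + z)) := by
        refine lintegral_mono fun z => ?_
        by_cases hz : x + z ∈ A ∩ J
        · have := h _ hz.2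
          rw [add_sub_cancel_left] at this
          simp only [indicator_of_mem hz, Pi.one_apply, mul_one]
          rw [← ENNReal.ofReal_mul (gaussDensity_pos hσ z).le, mul_comm (gaussDensity σ z)]
          exact ENNReal.ofReal_le_ofReal this
        · simp [indicator_of_notMem hz]
    _ = ∫⁻ z, ENNReal.ofReal (acceptProb σ x (x + z)) * (A ∩ J).indicator 1 (x + z)
          ∂gaussMeasure σ := by
        rw [gaussMeasure, lintegral_withDensity_eq_lintegral_mul _ hφ.ennreal_ofReal (by fun_prop)]
        rfl
    _ ≤ _ := by
        refine lintegral_mono fun z => le_trans ?_ le_self_add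
        by_cases hz : x + z ∈ A ∩ J
        · have hneg : x + z < 0 := by linarith [hz.2.2]
          simp [indicator_of_mem hz, indicator_of_mem hz.1, hneg]
        · simp [indicator_of_notMem hz]

lemma exists_minorization {R : ℝ} (hR : 0 < R) :
    ∃ ε : ℝ, 0 < ε ∧ ε < 1 ∧ ∀ σ : ℝ, 0 < σ → σ < 1 → ∃ η : Measure ℝ,
      η univ = ENNReal.ofReal ε ∧
      ∀ x, lyapunov σ x ≤ ENNReal.ofReal R → η ≤ rwmKernelHat σ x := by
  set c := Real.exp (-(3 / 2)) / (8 * √(2 * Real.pi) * R ^ 4) with hc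
  have hc0 : 0 < c := by positivity
  refine ⟨2 * min c (1 / 4), by positivity, by linarith [min_le_right c (1 / 4)],
    fun σ hσ hσ1 => ⟨ENNReal.ofReal (min c (1 / 4) / σ) •
      volume.restrict (Icc (-1 - σ) (-1 + σ)), ?_, fun x hx => ?_⟩⟩
  · rw [Measure.smul_apply, Measure.restrict_apply MeasurableSet.univ, univ_inter,
      Real.volume_Icc, smul_eq_mul, ← ENNReal.ofReal_mul (by positivity)]
    congr 1
    field_simp
    ring
  · have hx0 : x < 0 := by
      by_contra h
      rw [lyapunov, if_neg h] at hx
      exact ENNReal.ofReal_ne_top (top_le_iff.1 hx)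
    refine smul_restrict_le_rwmKernelHat hσ hσ1 fun y hy => ?_
    refine le_trans ?_ (le_acceptProb_mul_gaussDensity hσ hR hx0 hx hy)
    gcongr
    exact min_le_left _ _

/-- Geometric ergodicity of the restricted kernel, with rates that do not depend on `σ`. -/
lemma exists_kiter_rwmKernelHat_le : ∃ r β : ℝ, 0 < r ∧ r < 1 ∧ 0 < β ∧
    ∀ σ : ℝ, 0 < σ → σ < 1 → ∀ n : ℕ, ∀ B : Set ℝ, MeasurableSet B → ∀ x y : ℝ,
      kiter (rwmKernelHat σ) n x B ≤ kiter (rwmKernelHat σ) n y B + ENNReal.ofReal r ^ n *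
        (2 + ENNReal.ofReal β * lyapunov σ x + ENNReal.ofReal β * lyapunov σ y) := by
  set b := 5 / 4 * Real.exp (505 ^ 2 / 4) with hb
  have hb0 : 0 < b := by positivity
  obtain ⟨ε, hε0, hε1, hmin⟩ := exists_minorization (R := 8 * b / (1 - 9 / 10))
    (div_pos (by positivity) (by norm_num))
  refine ⟨max (1 - ε / 2) ((1 + 9 / 10) / 2), ε / (2 * b), ?_, ?_, by positivity, ?_⟩
  · exact lt_max_of_lt_right (by norm_num)
  · exact max_lt (by linarith) (by norm_num)
  intro σ hσ hσ1 n B hB x y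
  obtain ⟨η, hη, hηle⟩ := hmin σ hσ hσ1
  have := lintegral_kiter_le_of_drift_of_minorization (measurable_rwmKernelHat hσ)
    (isProbabilityMeasure_rwmKernelHat hσ) (measurable_lyapunov σ) (by norm_num) (by norm_num)
    hb0 hε0 hε1 (lintegral_lyapunov_drift hσ) hη hηle n
    (φ := B.indicator 1) (measurable_one.indicator hB) (c := 1)
    (fun a a' => by
      rw [one_mul, add_assoc]
      refine (indicator_le_self' (fun _ _ => zero_le) a).trans (le_trans ?_ le_add_self)
      exact one_le_two.trans le_self_add) x y
  simpa only [lintegral_indicator_one hB, one_mul] using this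

lemma lyapunov_le_exp_inv_pow {σ x : ℝ} (hσ : 0 < σ) (hσ1 : σ < 1) (hx : x < 0)
    (hx' : -(1 / σ ^ 9) < x) :
    lyapunov σ x ≤ ENNReal.ofReal (Real.exp ((1 / σ) ^ 25)) := by
  refine (lyapunov_le_exp hx).trans (ENNReal.ofReal_le_ofReal ?_)
  have ht : 1 ≤ 1 / σ := (one_le_div hσ).2 hσ1.le
  have ht9 : 1 ≤ 1 / σ ^ 9 := (one_le_div (by positivity)).2 (pow_le_one₀ hσ.le hσ1.le)
  have hsq : (x + 1) ^ 2 ≤ (1 / σ ^ 9) ^ 2 := sq_le_sq' (by linarith) (by linarith)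
  rw [Real.exp_le_exp]
  calc (x + 1) ^ 2 / (4 * σ ^ 2) ≤ (1 / σ ^ 9) ^ 2 / (1 * σ ^ 2) := by
        gcongr
        norm_num
    _ = (1 / σ) ^ 20 := by field_simp
    _ ≤ (1 / σ) ^ 25 := pow_le_pow_right₀ ht (by norm_num)

/-- A geometric rate run for `⌈A t ^ 25⌉` steps beats a prefactor `exp (t ^ 25)`. -/
lemma exists_pow_ceil_mul_exp_le {r β : ℝ} (hr0 : 0 < r) (hr1 : r < 1) (hβ : 0 < β) :
    ∃ A : ℝ, 0 < A ∧ ∀ t : ℝ, 1 ≤ t →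
      r ^ ⌈A * t ^ 25⌉₊ * (2 + 2 * β * Real.exp (t ^ 25)) ≤ A * Real.exp (-25 * t ^ 5) := by
  have hk : 0 < -Real.log r := neg_pos.2 (Real.log_neg hr0 hr1)
  refine ⟨2 + 2 * β + 26 / -Real.log r, by positivity, fun t ht => ?_⟩
  set A := 2 + 2 * β + 26 / -Real.log r with hA
  have hA1 : 2 + 2 * β ≤ A := le_add_of_nonneg_right (by positivity)
  have hA2 : 26 ≤ A * -Real.log r := by
    rw [← div_le_iff₀ hk]
    exact le_add_of_nonneg_left (by positivity)
  have h1 : r ^ ⌈A * t ^ 25⌉₊ ≤ Real.exp (-(26 * t ^ 25)) := by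
    rw [← Real.rpow_natCast, Real.rpow_def_of_pos hr0, Real.exp_le_exp]
    have := mul_le_mul_of_nonneg_right (Nat.le_ceil (A * t ^ 25)) hk.le
    have := mul_le_mul_of_nonneg_right hA2 (by positivity : 0 ≤ t ^ 25)
    linarith
  have h2 : 2 + 2 * β * Real.exp (t ^ 25) ≤ A * Real.exp (t ^ 25) := by
    have : 1 ≤ Real.exp (t ^ 25) := Real.one_le_exp (by positivity)
    have := mul_le_mul_of_nonneg_right hA1 (Real.exp_pos (t ^ 25)).le
    linarith
  calc _ ≤ Real.exp (-(26 * t ^ 25)) * (A * Real.exp (t ^ 25)) := by gcongr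
    _ = A * Real.exp (-25 * t ^ 25) := by
      rw [mul_left_comm, ← Real.exp_add]
      ring_nf
    _ ≤ _ := by
      have : t ^ 5 ≤ t ^ 25 := pow_le_pow_right₀ ht (by norm_num)
      gcongr ?_ * Real.exp ?_
      linarith

/-- Improved coupling estimate: with `S = ⌈A₂ σ^{-a₂}⌉` steps, the laws `K̂_σ^S(x,·)` and
`K̂_σ^S(y,·)` are within `A₂ e^{-a₂ σ^{-5}}` in total variation, uniformly over
`x, y ∈ (-σ^{-9}, -δ)`. -/
theorem stmt13 (δ : ℝ) (hδ0 : 0 < δ) (hδ : δ < 1 / 20) :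
    ∃ a A : ℝ, 0 < a ∧ 0 < A ∧ ∃ σ₀ : ℝ, 0 < σ₀ ∧
      ∀ σ : ℝ, 0 < σ → σ < σ₀ →
        ∀ x ∈ Set.Ioo (-(1 / σ ^ 9)) (-δ), ∀ y ∈ Set.Ioo (-(1 / σ ^ 9)) (-δ),
          ∀ B : Set ℝ, MeasurableSet B →
            |(kiter (rwmKernelHat σ) ⌈A * σ ^ (-a)⌉₊ x B).toReal
                - (kiter (rwmKernelHat σ) ⌈A * σ ^ (-a)⌉₊ y B).toReal|
              ≤ A * Real.exp (-a / σ ^ 5) := by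
  obtain ⟨r, β, hr0, hr1, hβ, hcontr⟩ := exists_kiter_rwmKernelHat_le
  obtain ⟨A, hA, hrate⟩ := exists_pow_ceil_mul_exp_le hr0 hr1 hβ
  refine ⟨25, A, by norm_num, hA, 1, one_pos, fun σ hσ hσ1 x hx y hy B hB => ?_⟩
  have hpow : σ ^ (-(25 : ℝ)) = (1 / σ) ^ 25 := by
    rw [Real.rpow_neg hσ.le, one_div, inv_pow, ← Real.rpow_natCast]
    norm_num
  rw [hpow]
  set n := ⌈A * (1 / σ) ^ 25⌉₊ with hn
  have hfin : ∀ z, kiter (rwmKernelHat σ) n z B ≠ ∞ := fun z =>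
    have := isProbabilityMeasure_kiter (measurable_rwmKernelHat hσ)
      (isProbabilityMeasure_rwmKernelHat hσ) n z
    measure_ne_top _ _
  have hbound : r ^ n * (2 + 2 * β * Real.exp ((1 / σ) ^ 25)) ≤ A * Real.exp (-25 / σ ^ 5) := by
    have := hrate (1 / σ) ((one_le_div hσ).2 hσ1.le)
    rwa [show -25 * (1 / σ) ^ 5 = -25 / σ ^ 5 by rw [one_div_pow, mul_one_div]] at this
  have hle : ∀ u ∈ Ioo (-(1 / σ ^ 9)) (-δ), ∀ v ∈ Ioo (-(1 / σ ^ 9)) (-δ),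
      (kiter (rwmKernelHat σ) n u B).toReal ≤
        (kiter (rwmKernelHat σ) n v B).toReal + A * Real.exp (-25 / σ ^ 5) := by
    intro u hu v hv
    have hVu := lyapunov_le_exp_inv_pow hσ hσ1 (by linarith [hu.2]) hu.1
    have hVv := lyapunov_le_exp_inv_pow hσ hσ1 (by linarith [hv.2]) hv.1
    have h : kiter (rwmKernelHat σ) n u B ≤ kiter (rwmKernelHat σ) n v B +
        ENNReal.ofReal (A * Real.exp (-25 / σ ^ 5)) := by
      refine (hcontr σ hσ hσ1 n B hB u v).trans ?_
      gcongr
      refine le_trans ?_ (ENNReal.ofReal_le_ofReal hbound)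
      rw [ENNReal.ofReal_mul (by positivity), ENNReal.ofReal_pow hr0.le, mul_assoc 2,
        two_mul (β * _), ENNReal.ofReal_add two_pos.le (by positivity),
        ENNReal.ofReal_add (by positivity) (by positivity), ENNReal.ofReal_mul hβ.le,
        ENNReal.ofReal_ofNat, ← add_assoc]
      gcongr
    rw [← ENNReal.toReal_ofReal (by positivity : 0 ≤ A * Real.exp (-25 / σ ^ 5)),
      ← ENNReal.toReal_add (hfin v) ENNReal.ofReal_ne_top]
    exact ENNReal.toReal_mono (ENNReal.add_ne_top.2 ⟨hfin v, ENNReal.ofReal_ne_top⟩) h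
  rw [abs_le]
  constructor
  · linarith [hle y hy x hx]
  · linarith [hle x hx y hy]
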